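/- Let n ≥ 1 be an integer, 1 < p < ∞, T > 0, K₂ > 0, and let f : [0,∞) → [0,∞) be a locally integrable function with f(u) ≥ K₂ u^p for all u ≥ 0. Let ϑ₀ : ℝⁿ → [0,∞] be measurable and let ϑ : [0,T] × ℝⁿ → [0,∞] be measurable with ϑ(t,x) < ∞ for almost every (t,x), satisfying the integral equation ϑ(t,x) = (e^{−tΔ}ϑ₀)(x) + ∫₀ᵗ (e^{−(t−s)Δ} f(ϑ(s,·)))(x) ds for almost every (t,x) ∈ [0,T] × ℝⁿ. Then for almost every τ ∈ (0,T) and every t ∈ (0, T−τ], t^{1/(p−1)} ‖e^{−tΔ}(ϑ(τ,·))‖_{L^∞(ℝⁿ)} ≤ (K₂(p−1))^{−1/(p−1)}. -/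

import Mathlib

open MeasureTheory Real ENNReal

/-- The Gaussian heat kernel `h_t(x) = (4πt)^(-n/2) exp(-‖x‖²/(4t))` on `ℝⁿ`. -/
noncomputable def heatKernel (n : ℕ) (t : ℝ) (x : EuclideanSpace ℝ (Fin n)) : ℝ :=
  (4 * Real.pi * t) ^ (-(n : ℝ) / 2) * Real.exp (-‖x‖ ^ 2 / (4 * t))

/-- The heat semigroup `e^{-tΔ}` acting on nonnegative extended-real-valued functions:
`(e^{-tΔ}v)(x) = ∫ h_t(x-y) v(y) dy` for `t ≠ 0`, and the identity at `t = 0`. -/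
noncomputable def heatSem (n : ℕ) (t : ℝ) (v : EuclideanSpace ℝ (Fin n) → ℝ≥0∞)
    (x : EuclideanSpace ℝ (Fin n)) : ℝ≥0∞ :=
  if t = 0 then v x else ∫⁻ y, ENNReal.ofReal (heatKernel n t (x - y)) * v y


open Filter Topology Set

lemma heatKernel_pos (n : ℕ) {t : ℝ} (ht : 0 < t) (x : EuclideanSpace ℝ (Fin n)) :
    0 < heatKernel n t x := by
  unfold heatKernel
  positivity

lemma measurable_uncurry_heatKernel (n : ℕ) :
    Measurable fun q : ℝ × EuclideanSpace ℝ (Fin n) => heatKernel n q.1 q.2 := by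
  unfold heatKernel
  fun_prop

/-- The heat kernel with values in `ℝ≥0∞`. -/
noncomputable def eheatKernel (n : ℕ) (t : ℝ) (x : EuclideanSpace ℝ (Fin n)) : ℝ≥0∞ :=
  ENNReal.ofReal (heatKernel n t x)

lemma measurable_uncurry_eheatKernel (n : ℕ) :
    Measurable fun q : ℝ × EuclideanSpace ℝ (Fin n) => eheatKernel n q.1 q.2 :=
  (measurable_uncurry_heatKernel n).ennreal_ofReal

@[fun_prop]
lemma Measurable.eheatKernel {α : Type*} [MeasurableSpace α] {n : ℕ} {t : α → ℝ}
    {x : α → EuclideanSpace ℝ (Fin n)} (ht : Measurable t) (hx : Measurable x) :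
    Measurable fun a => eheatKernel n (t a) (x a) :=
  (measurable_uncurry_eheatKernel n).comp (ht.prodMk hx)

lemma eheatKernel_pos (n : ℕ) {t : ℝ} (ht : 0 < t) (x : EuclideanSpace ℝ (Fin n)) :
    0 < eheatKernel n t x :=
  ENNReal.ofReal_pos.2 (heatKernel_pos n ht x)

lemma eheatKernel_ne_top (n : ℕ) (t : ℝ) (x : EuclideanSpace ℝ (Fin n)) :
    eheatKernel n t x ≠ ⊤ :=
  ENNReal.ofReal_ne_top

lemma lintegral_eheatKernel (n : ℕ) {t : ℝ} (ht : 0 < t) :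
    ∫⁻ x, eheatKernel n t x = 1 := by
  have hb : 0 < 1 / (4 * t) := by positivity
  have hI := GaussianFourier.integral_rexp_neg_mul_sq_norm
    (V := EuclideanSpace ℝ (Fin n)) hb
  have h_int : Integrable fun v : EuclideanSpace ℝ (Fin n) => rexp (-(1 / (4 * t)) * ‖v‖ ^ 2) := by
    refine Integrable.of_integral_ne_zero ?_
    rw [hI]
    positivity
  have hk : ∀ x : EuclideanSpace ℝ (Fin n), heatKernel n t x
      = (4 * Real.pi * t) ^ (-(n : ℝ) / 2) * rexp (-(1 / (4 * t)) * ‖x‖ ^ 2) := fun x => by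
    unfold heatKernel
    congr 2
    ring
  unfold eheatKernel
  rw [← ofReal_integral_eq_lintegral_ofReal]
  · simp_rw [hk]
    rw [integral_const_mul, hI, finrank_euclideanSpace_fin,
      show Real.pi / (1 / (4 * t)) = 4 * Real.pi * t by field_simp,
      ← Real.rpow_add (by positivity)]
    simp [neg_div]
  · exact (h_int.const_mul _).congr (ae_of_all _ fun x => (hk x).symm)
  · exact ae_of_all _ fun x => (heatKernel_pos n ht x).le

lemma lintegral_eheatKernel_sub_left (n : ℕ) {t : ℝ} (ht : 0 < t)
    (x : EuclideanSpace ℝ (Fin n)) : ∫⁻ y, eheatKernel n t (x - y) = 1 := by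
  rw [lintegral_sub_left_eq_self (fun y => eheatKernel n t y) x, lintegral_eheatKernel n ht]

lemma heatKernel_mul_heatKernel (n : ℕ) {a b : ℝ} (ha : 0 < a) (hb : 0 < b)
    (x y z : EuclideanSpace ℝ (Fin n)) :
    heatKernel n b (x - z) * heatKernel n a (z - y)
      = heatKernel n (a + b) (x - y)
        * heatKernel n (a * b / (a + b)) (z - ((a / (a + b)) • x + (b / (a + b)) • y)) := by
  have hab : 0 < a + b := by positivity
  unfold heatKernel
  rw [mul_mul_mul_comm, mul_mul_mul_comm ((4 * Real.pi * (a + b)) ^ (-(n : ℝ) / 2)),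
    ← Real.mul_rpow (by positivity) (by positivity), ← Real.mul_rpow (by positivity) (by positivity),
    ← Real.exp_add, ← Real.exp_add]
  congr 2
  · field_simp
  · have h1 : z - ((a / (a + b)) • x + (b / (a + b)) • y)
        = (b / (a + b)) • (z - y) - (a / (a + b)) • (x - z) := by
      have : z = (a / (a + b)) • z + (b / (a + b)) • z := by
        rw [← add_smul, ← add_div, div_self hab.ne', one_smul]
      nth_rewrite 1 [this]
      module
    have h2 : x - y = (x - z) + (z - y) := by abel
    rw [h1, h2]
    generalize x - z = u
    generalize z - y = v
    rw [norm_sub_sq_real, norm_add_sq_real, norm_smul, norm_smul, inner_smul_left,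
      inner_smul_right, real_inner_comm, Real.norm_of_nonneg (by positivity),
      Real.norm_of_nonneg (by positivity)]
    simp only [conj_trivial]
    field_simp
    ring

lemma lintegral_eheatKernel_mul_eheatKernel (n : ℕ) {a b : ℝ} (ha : 0 < a) (hb : 0 < b)
    (x y : EuclideanSpace ℝ (Fin n)) :
    ∫⁻ z, eheatKernel n b (x - z) * eheatKernel n a (z - y) = eheatKernel n (a + b) (x - y) := by
  have h : ∀ z, eheatKernel n b (x - z) * eheatKernel n a (z - y)
      = eheatKernel n (a + b) (x - y) * eheatKernel n (a * b / (a + b))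
        (z - ((a / (a + b)) • x + (b / (a + b)) • y)) := fun z => by
    unfold eheatKernel
    rw [← ENNReal.ofReal_mul (heatKernel_pos n hb _).le,
      ← ENNReal.ofReal_mul (heatKernel_pos n (add_pos ha hb) _).le,
      heatKernel_mul_heatKernel n ha hb]
  simp_rw [h]
  rw [lintegral_const_mul _ (by fun_prop),
    lintegral_sub_right_eq_self (fun z => eheatKernel n (a * b / (a + b)) z),
    lintegral_eheatKernel n (by positivity), mul_one]

/-- An elementary parabolic Harnack inequality for the heat kernel. -/
lemma eheatKernel_harnack (n : ℕ) {a δ ρ : ℝ} (ha : 0 < a) (hδ : 0 < δ)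
    {z z' : EuclideanSpace ℝ (Fin n)} (hz : ‖z' - z‖ ≤ ρ) (y : EuclideanSpace ℝ (Fin n)) :
    ENNReal.ofReal ((a / (a + δ)) ^ ((n : ℝ) / 2)) * eheatKernel n a (z - y)
      ≤ ENNReal.ofReal (rexp (ρ ^ 2 / (4 * δ))) * eheatKernel n (a + δ) (z' - y) := by
  have hρ : 0 ≤ ρ := (norm_nonneg _).trans hz
  have haδ : 0 < a + δ := by positivity
  unfold eheatKernel heatKernel
  rw [← ENNReal.ofReal_mul (by positivity), ← ENNReal.ofReal_mul (by positivity)]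
  refine ENNReal.ofReal_le_ofReal ?_
  have hc : (a / (a + δ)) ^ ((n : ℝ) / 2) * (4 * Real.pi * a) ^ (-(n : ℝ) / 2)
      = (4 * Real.pi * (a + δ)) ^ (-(n : ℝ) / 2) := by
    rw [neg_div, Real.rpow_neg (by positivity), Real.rpow_neg (by positivity),
      Real.div_rpow ha.le haδ.le, Real.mul_rpow (by positivity) ha.le,
      Real.mul_rpow (by positivity) haδ.le]
    field_simp
  rw [← mul_assoc, hc, mul_left_comm, ← Real.exp_add]
  gcongr
  set u := ‖z - y‖
  have hn : ‖z' - y‖ ≤ u + ρ := by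
    have : z' - y = (z - y) + (z' - z) := by abel
    rw [this]
    exact (norm_add_le _ _).trans (by gcongr)
  have hsq : ‖z' - y‖ ^ 2 / (4 * (a + δ)) ≤ (u + ρ) ^ 2 / (4 * (a + δ)) := by gcongr
  have hid : u ^ 2 / (4 * a) + ρ ^ 2 / (4 * δ) - (u + ρ) ^ 2 / (4 * (a + δ))
      = (u * δ - ρ * a) ^ 2 / (4 * a * δ * (a + δ)) := by
    field_simp
    ring
  have hpos : 0 ≤ (u * δ - ρ * a) ^ 2 / (4 * a * δ * (a + δ)) := by positivity
  rw [neg_div, neg_div]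
  linarith

/-- A measurable weight only sees the largest measurable minorant of a nonmeasurable function. -/
lemma exists_measurable_le_forall_lintegral_mul_eq {α : Type*} [MeasurableSpace α]
    {μ : Measure α} [SigmaFinite μ] (f : α → ℝ≥0∞) :
    ∃ g : α → ℝ≥0∞, Measurable g ∧ g ≤ f ∧ ∀ w : α → ℝ≥0∞, Measurable w → (∀ a, w a ≠ 0) →
      (∀ a, w a ≠ ⊤) → ∫⁻ a, w a * f a ∂μ = ∫⁻ a, w a * g a ∂μ := by
  obtain ⟨g, hg, hgf, h_int⟩ := exists_measurable_le_forall_setLIntegral_eq (μ := μ) f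
  refine ⟨g, hg, hgf, fun w hw hw0 hwt => le_antisymm ?_ ?_⟩
  · obtain ⟨m, hm, hmf, hmint⟩ := exists_measurable_le_lintegral_eq (μ := μ) fun a => w a * f a
    have hle : (fun a => (w a)⁻¹ * m a) ≤ᵐ[μ] g := by
      refine ae_le_of_forall_setLIntegral_le_of_sigmaFinite (hw.inv.mul hm) fun s _ _ => ?_
      rw [← h_int s]
      refine lintegral_mono fun a => ?_
      calc (w a)⁻¹ * m a ≤ (w a)⁻¹ * (w a * f a) := by gcongr; exact hmf a
        _ = f a := by rw [← mul_assoc, ENNReal.inv_mul_cancel (hw0 a) (hwt a), one_mul]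
    rw [hmint]
    refine lintegral_mono_ae (hle.mono fun a ha => ?_)
    calc m a = w a * ((w a)⁻¹ * m a) := by
          rw [← mul_assoc, ENNReal.mul_inv_cancel (hw0 a) (hwt a), one_mul]
      _ ≤ w a * g a := by gcongr
  · exact lintegral_mono fun a => by gcongr; exact hgf a

/-- Superadditivity of the lower integral along a countable sum. -/
lemma lintegral_lintegral_le_of_countable {α ι : Type*} [MeasurableSpace α] [MeasurableSpace ι]
    [Countable ι] [MeasurableSingletonClass ι] (μ : Measure α) (ν : Measure ι)
    (G : α → ι → ℝ≥0∞) :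
    ∫⁻ i, ∫⁻ a, G a i ∂μ ∂ν ≤ ∫⁻ a, ∫⁻ i, G a i ∂ν ∂μ := by
  classical
  simp_rw [lintegral_countable']
  rw [ENNReal.tsum_eq_iSup_sum]
  refine iSup_le fun s => ?_
  have hs : ∑ i ∈ s, (∫⁻ a, G a i ∂μ) * ν {i} ≤ ∫⁻ a, ∑ i ∈ s, G a i * ν {i} ∂μ := by
    induction s using Finset.induction_on with
    | empty => simp
    | insert i s hi ih =>
      simp_rw [Finset.sum_insert hi]
      refine (add_le_add ?_ ih).trans (le_lintegral_add _ _)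
      simp_rw [mul_comm _ (ν {i})]
      exact lintegral_const_mul_le _ _
  exact hs.trans (lintegral_mono fun a => ENNReal.sum_le_tsum s)

/-- A one-sided Tonelli inequality for a nonmeasurable integrand depending on one variable only
through a countably valued function. -/
lemma lintegral_mul_lintegral_comp_le {α β ι : Type*} [MeasurableSpace α] [MeasurableSpace β]
    [MeasurableSpace ι] [Countable ι] [MeasurableSingletonClass ι] [DiscreteMeasurableSpace ι]
    (μ : Measure α) (ν : Measure β) {H : β → ℝ≥0∞} (hH : Measurable H) {j : β → ι}
    (hj : Measurable j) (G : α → ι → ℝ≥0∞) :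
    ∫⁻ z, H z * ∫⁻ a, G a (j z) ∂μ ∂ν ≤ ∫⁻ a, ∫⁻ z, H z * G a (j z) ∂ν ∂μ := by
  have key : ∀ g : ι → ℝ≥0∞,
      ∫⁻ z, H z * g (j z) ∂ν = ∫⁻ i, g i ∂((ν.withDensity H).map j) := fun g => by
    have hg : Measurable g := measurable_of_countable g
    rw [lintegral_map hg hj,
      lintegral_withDensity_eq_lintegral_mul _ hH (g := fun z => g (j z)) (hg.comp hj)]
    rfl
  rw [key fun i => ∫⁻ a, G a i ∂μ]
  simp_rw [fun a => key (G a)]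
  exact lintegral_lintegral_le_of_countable _ _ _

/-- A separable metric space has countable measurable discretisations of arbitrarily small mesh. -/
lemma exists_measurable_nat_dist_lt {X : Type*} [PseudoMetricSpace X]
    [TopologicalSpace.SeparableSpace X] [Nonempty X] [MeasurableSpace X] [OpensMeasurableSpace X]
    {ρ : ℝ} (hρ : 0 < ρ) :
    ∃ (c : ℕ → X) (j : X → ℕ), Measurable j ∧ ∀ z, dist z (c (j z)) < ρ := by
  classical
  have hex : ∀ z : X, ∃ k, dist z (TopologicalSpace.denseSeq X k) < ρ := fun z => by
    exact (TopologicalSpace.denseRange_denseSeq X).exists_dist_lt z hρ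
  refine ⟨TopologicalSpace.denseSeq X, fun z => Nat.find (hex z), measurable_find hex fun k => ?_,
    fun z => Nat.find_spec (hex z)⟩
  exact (isOpen_lt (by fun_prop) continuous_const).measurableSet

/-- The heat semigroup written as an integral also at `t = 0`. -/
noncomputable def heatInt (n : ℕ) (t : ℝ) (v : EuclideanSpace ℝ (Fin n) → ℝ≥0∞)
    (x : EuclideanSpace ℝ (Fin n)) : ℝ≥0∞ :=
  ∫⁻ y, eheatKernel n t (x - y) * v y

lemma heatSem_eq_heatInt (n : ℕ) {t : ℝ} (ht : t ≠ 0) (v : EuclideanSpace ℝ (Fin n) → ℝ≥0∞)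
    (x : EuclideanSpace ℝ (Fin n)) : heatSem n t v x = heatInt n t v x :=
  if_neg ht

lemma heatInt_mono_ae (n : ℕ) (t : ℝ) {v w : EuclideanSpace ℝ (Fin n) → ℝ≥0∞}
    (h : v ≤ᵐ[volume] w) (x : EuclideanSpace ℝ (Fin n)) : heatInt n t v x ≤ heatInt n t w x :=
  lintegral_mono_ae (h.mono fun y hy => by gcongr)

lemma measurable_heatInt_comp {α : Type*} [MeasurableSpace α] (n : ℕ) {t : α → ℝ}
    (ht : Measurable t) {x : α → EuclideanSpace ℝ (Fin n)} (hx : Measurable x)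
    {v : α → EuclideanSpace ℝ (Fin n) → ℝ≥0∞} (hv : Measurable (Function.uncurry v)) :
    Measurable fun a => heatInt n (t a) (v a) (x a) := by
  unfold heatInt
  refine Measurable.lintegral_prod_right'
    (f := fun q : α × EuclideanSpace ℝ (Fin n) =>
      eheatKernel n (t q.1) (x q.1 - q.2) * v q.1 q.2) ?_
  exact Measurable.mul (by fun_prop) hv

lemma measurable_heatInt (n : ℕ) (t : ℝ) (v : EuclideanSpace ℝ (Fin n) → ℝ≥0∞)
    (hv : Measurable v) : Measurable (heatInt n t v) :=
  measurable_heatInt_comp n measurable_const measurable_id (v := fun _ => v)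
    (hv.comp measurable_snd)

lemma heatInt_heatInt_of_measurable (n : ℕ) {a b : ℝ} (ha : 0 < a) (hb : 0 < b)
    {v : EuclideanSpace ℝ (Fin n) → ℝ≥0∞} (hv : Measurable v) (x : EuclideanSpace ℝ (Fin n)) :
    heatInt n b (heatInt n a v) x = heatInt n (a + b) v x := by
  unfold heatInt
  calc ∫⁻ z, eheatKernel n b (x - z) * ∫⁻ y, eheatKernel n a (z - y) * v y
      = ∫⁻ z, ∫⁻ y, eheatKernel n b (x - z) * (eheatKernel n a (z - y) * v y) :=
        lintegral_congr fun z => (lintegral_const_mul _ (by fun_prop)).symm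
    _ = ∫⁻ y, ∫⁻ z, eheatKernel n b (x - z) * (eheatKernel n a (z - y) * v y) :=
        lintegral_lintegral_swap (by unfold Function.uncurry; fun_prop)
    _ = _ := lintegral_congr fun y => by
        simp_rw [← mul_assoc]
        rw [lintegral_mul_const _ (by fun_prop), lintegral_eheatKernel_mul_eheatKernel n ha hb]

lemma heatInt_heatInt (n : ℕ) {a b : ℝ} (ha : 0 < a) (hb : 0 < b)
    (v : EuclideanSpace ℝ (Fin n) → ℝ≥0∞) (x : EuclideanSpace ℝ (Fin n)) :
    heatInt n b (heatInt n a v) x = heatInt n (a + b) v x := by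
  obtain ⟨g, hg, -, h⟩ := exists_measurable_le_forall_lintegral_mul_eq (μ := volume) v
  have hvg : ∀ c, 0 < c → heatInt n c v = heatInt n c g := fun c hc => funext fun z =>
    h _ (by fun_prop) (fun y => (eheatKernel_pos n hc _).ne') fun y => eheatKernel_ne_top n c _
  rw [hvg a ha, hvg (a + b) (by positivity), heatInt_heatInt_of_measurable n ha hb hg]

lemma heatInt_harnack (n : ℕ) {a δ ρ : ℝ} (ha : 0 < a) (hδ : 0 < δ)
    {z z' : EuclideanSpace ℝ (Fin n)} (hz : ‖z' - z‖ ≤ ρ)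
    (v : EuclideanSpace ℝ (Fin n) → ℝ≥0∞) :
    ENNReal.ofReal ((a / (a + δ)) ^ ((n : ℝ) / 2)) * heatInt n a v z
      ≤ ENNReal.ofReal (rexp (ρ ^ 2 / (4 * δ))) * heatInt n (a + δ) v z' := by
  unfold heatInt
  rw [← lintegral_const_mul' _ _ ENNReal.ofReal_ne_top,
    ← lintegral_const_mul' _ _ ENNReal.ofReal_ne_top]
  refine lintegral_mono fun y => ?_
  simp_rw [← mul_assoc]
  gcongr ?_ * _
  exact eheatKernel_harnack n ha hδ hz y

lemma heatInt_ne_top_of_lt (n : ℕ) {a b : ℝ} (ha : 0 < a) (hab : a < b)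
    {z z' : EuclideanSpace ℝ (Fin n)} {v : EuclideanSpace ℝ (Fin n) → ℝ≥0∞}
    (h : heatInt n b v z' ≠ ⊤) : heatInt n a v z ≠ ⊤ := by
  intro htop
  have hk := heatInt_harnack n ha (sub_pos.2 hab) (le_refl ‖z' - z‖) v
  have hw : ENNReal.ofReal ((a / (a + (b - a))) ^ ((n : ℝ) / 2)) ≠ 0 := by
    have hb := ha.trans hab
    rw [add_sub_cancel, ENNReal.ofReal_ne_zero_iff]
    positivity
  rw [htop, ENNReal.mul_top hw, top_le_iff, add_sub_cancel] at hk
  exact ENNReal.mul_ne_top ENNReal.ofReal_ne_top h hk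

lemma heatInt_rpow_le (n : ℕ) {t p : ℝ} (ht : 0 < t) (hp : 1 < p)
    {v : EuclideanSpace ℝ (Fin n) → ℝ≥0∞} (hv : Measurable v) (x : EuclideanSpace ℝ (Fin n)) :
    heatInt n t v x ^ p ≤ heatInt n t (fun y => v y ^ p) x := by
  have hk : Measurable fun y => eheatKernel n t (x - y) := by fun_prop
  have hpr : IsProbabilityMeasure (volume.withDensity fun y => eheatKernel n t (x - y)) :=
    ⟨by rw [withDensity_apply _ MeasurableSet.univ, setLIntegral_univ,
      lintegral_eheatKernel_sub_left n ht]⟩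
  have h := eLpNorm'_le_eLpNorm'_of_exponent_le one_pos hp.le
    (volume.withDensity fun y => eheatKernel n t (x - y)) hv.aestronglyMeasurable
  simp only [eLpNorm', enorm_eq_self, ENNReal.rpow_one, div_one] at h
  rw [lintegral_withDensity_eq_lintegral_mul _ hk hv,
    lintegral_withDensity_eq_lintegral_mul _ hk (hv.pow_const p),
    one_div, ENNReal.le_rpow_inv_iff (by positivity)] at h
  exact h

/-- Fatou's lemma for the heat semigroup as the time increases to `t`. -/
lemma heatInt_le_liminf (n : ℕ) {t : ℝ} (ht : 0 < t) {s : ℕ → ℝ} (hs : Tendsto s atTop (𝓝 t))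
    {v : EuclideanSpace ℝ (Fin n) → ℝ≥0∞} {w : ℕ → EuclideanSpace ℝ (Fin n) → ℝ≥0∞}
    (hw : ∀ k, Measurable (w k)) (hvw : ∀ y, v y ≤ liminf (fun k => w k y) atTop)
    (x : EuclideanSpace ℝ (Fin n)) :
    heatInt n t v x ≤ liminf (fun k => heatInt n (s k) (w k) x) atTop := by
  unfold heatInt
  refine le_trans (lintegral_mono fun y => ?_) (lintegral_liminf_le fun k => by fun_prop)
  have hlim : Tendsto (fun k => eheatKernel n (s k) (x - y)) atTop
      (𝓝 (eheatKernel n t (x - y))) := by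
    refine (ENNReal.continuous_ofReal.tendsto _).comp ?_
    unfold heatKernel
    have h1 : 4 * Real.pi * t ≠ 0 := by positivity
    have h2 : 4 * t ≠ 0 := by positivity
    exact ((hs.const_mul _).rpow_const (Or.inl h1)).mul
      ((Real.continuous_exp.tendsto _).comp (tendsto_const_nhds.div (hs.const_mul _) h2))
  calc eheatKernel n t (x - y) * v y
      ≤ liminf (fun k => eheatKernel n (s k) (x - y)) atTop * liminf (fun k => w k y) atTop := by
        rw [hlim.liminf_eq]
        gcongr
        exact hvw y
    _ ≤ _ := ENNReal.le_liminf_mul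

lemma exists_measurable_approx_lintegral_heatInt (n : ℕ) {τ δ : ℝ} (hδ : 0 < δ)
    (F : ℝ → EuclideanSpace ℝ (Fin n) → ℝ≥0∞) :
    ∃ L : EuclideanSpace ℝ (Fin n) → ℝ≥0∞, Measurable L ∧
      (∀ z, ∫⁻ r in Ioo 0 τ, ENNReal.ofReal (((τ - r) / (τ - r + δ)) ^ ((n : ℝ) / 2))
        * ENNReal.ofReal (((τ - r + δ) / (τ - r + δ + δ)) ^ ((n : ℝ) / 2))
        * heatInt n (τ - r) (F r) z ≤ L z) ∧
      ∀ b, 0 < b → ∀ x, heatInt n b L x ≤ ENNReal.ofReal (rexp δ) * ENNReal.ofReal (rexp δ)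
        * ∫⁻ r in Ioo 0 τ, heatInt n (τ - r + δ + δ + b) (F r) x := by
  obtain ⟨c, j, hj, hcj⟩ := exists_measurable_nat_dist_lt
    (X := EuclideanSpace ℝ (Fin n)) (ρ := 2 * δ) (by positivity)
  have hexp : (2 * δ) ^ 2 / (4 * δ) = δ := by field_simp; ring
  set C := ENNReal.ofReal (rexp δ) with hC
  have hCt : C ≠ ⊤ := ENNReal.ofReal_ne_top
  set G : ℝ → ℕ → ℝ≥0∞ := fun r i =>
    ENNReal.ofReal (((τ - r + δ) / (τ - r + δ + δ)) ^ ((n : ℝ) / 2))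
      * heatInt n (τ - r + δ) (F r) (c i) with hG
  refine ⟨fun z => C * ∫⁻ r in Ioo 0 τ, G r (j z), ?_, fun z => ?_, fun b hb x => ?_⟩
  · exact ((measurable_of_countable fun i => ∫⁻ r in Ioo 0 τ, G r i).comp hj).const_mul C
  · beta_reduce
    rw [← lintegral_const_mul' _ _ hCt]
    refine setLIntegral_mono' measurableSet_Ioo fun r hr => ?_
    have h := heatInt_harnack n (sub_pos.2 hr.2) hδ (ρ := 2 * δ) (z := z) (z' := c (j z))
      (by rw [← dist_eq_norm, dist_comm]; exact (hcj z).le) (F r)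
    rw [hexp] at h
    rw [mul_comm (ENNReal.ofReal _), mul_assoc, hG]
    simp only
    rw [mul_left_comm C]
    gcongr
  · have hmeas : Measurable fun z => eheatKernel n b (x - z) := by fun_prop
    calc heatInt n b (fun z => C * ∫⁻ r in Ioo 0 τ, G r (j z)) x
        = C * ∫⁻ z, eheatKernel n b (x - z) * ∫⁻ r in Ioo 0 τ, G r (j z) := by
          rw [← lintegral_const_mul' _ _ hCt]
          exact lintegral_congr fun z => mul_left_comm _ _ _
      _ ≤ C * ∫⁻ r in Ioo 0 τ, ∫⁻ z, eheatKernel n b (x - z) * G r (j z) := by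
          gcongr
          exact lintegral_mul_lintegral_comp_le _ _ hmeas hj G
      _ ≤ C * ∫⁻ r in Ioo 0 τ, C * heatInt n (τ - r + δ + δ + b) (F r) x := by
          refine mul_le_mul_right (setLIntegral_mono' measurableSet_Ioo fun r hr => ?_) C
          have hr' : 0 < τ - r := sub_pos.2 hr.2
          rw [← heatInt_heatInt n (by positivity) hb]
          unfold heatInt
          rw [← lintegral_const_mul' _ _ hCt]
          refine lintegral_mono fun z => ?_
          rw [mul_left_comm C]
          gcongr
          have h := heatInt_harnack n (add_pos hr' hδ) hδ (ρ := 2 * δ) (z := c (j z)) (z' := z)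
            (by rw [← dist_eq_norm]; exact (hcj z).le) (F r)
          rw [hexp] at h
          exact h
      _ = C * C * ∫⁻ r in Ioo 0 τ, heatInt n (τ - r + δ + δ + b) (F r) x := by
          rw [lintegral_const_mul' _ _ hCt, mul_assoc]

lemma tendsto_ofReal_ratio_rpow {a q : ℝ} (ha : 0 < a) {δ ε : ℕ → ℝ}
    (hδ : Tendsto δ atTop (𝓝 0)) (hε : Tendsto ε atTop (𝓝 0)) :
    Tendsto (fun m => ENNReal.ofReal (((a + ε m) / (a + ε m + δ m)) ^ q)) atTop (𝓝 1) := by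
  have h1 : Tendsto (fun m => a + ε m) atTop (𝓝 a) := by simpa using hε.const_add a
  have h2 : Tendsto (fun m => a + ε m + δ m) atTop (𝓝 a) := by simpa using h1.add hδ
  have h3 := (h1.div h2 ha.ne').rpow_const (p := q) (Or.inl (by simp [ha.ne']))
  rw [div_self ha.ne', Real.one_rpow] at h3
  simpa [Function.comp_def] using (ENNReal.continuous_ofReal.tendsto _).comp h3

/-- The heat semigroup acts on a Duhamel term whose source need not be measurable. -/
lemma heatInt_lintegral_heatInt_le (n : ℕ) {τ t : ℝ} (ht : 0 < t)
    (F : ℝ → EuclideanSpace ℝ (Fin n) → ℝ≥0∞) (x : EuclideanSpace ℝ (Fin n)) :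
    heatInt n t (fun z => ∫⁻ r in Ioo 0 τ, heatInt n (τ - r) (F r) z) x
      ≤ ∫⁻ r in Ioo 0 τ, heatInt n (τ - r + t) (F r) x := by
  set R := ∫⁻ r in Ioo 0 τ, heatInt n (τ - r + t) (F r) x
  let δ : ℕ → ℝ := fun m => t / 4 * (1 / ((m : ℝ) + 1))
  have hδ : ∀ m, 0 < δ m := fun m => by positivity
  have hδt : ∀ m, 0 < t - (δ m + δ m) := fun m => by
    have : 1 / ((m : ℝ) + 1) ≤ 1 := by
      rw [div_le_one (by positivity)]
      linarith [Nat.cast_nonneg (α := ℝ) m]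
    have : δ m ≤ t / 4 * 1 := mul_le_mul_of_nonneg_left this (by positivity)
    linarith
  have hδ0 : Tendsto δ atTop (𝓝 0) := by
    simpa [δ] using tendsto_one_div_add_atTop_nhds_zero_nat.const_mul (t / 4)
  choose L hLm hL hLb using fun m => exists_measurable_approx_lintegral_heatInt n (τ := τ) (hδ m) F
  have hs : Tendsto (fun m => t - (δ m + δ m)) atTop (𝓝 t) := by
    simpa using (hδ0.add hδ0).const_sub t
  refine (heatInt_le_liminf n ht hs hLm (fun z => ?_) x).trans ?_
  · obtain ⟨g, hg, hgle, hgint⟩ := exists_measurable_le_lintegral_eq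
      (μ := volume.restrict (Ioo 0 τ)) fun r => heatInt n (τ - r) (F r) z
    rw [hgint]
    let w : ℕ → ℝ → ℝ≥0∞ := fun m r =>
      ENNReal.ofReal (((τ - r) / (τ - r + δ m)) ^ ((n : ℝ) / 2))
        * ENNReal.ofReal (((τ - r + δ m) / (τ - r + δ m + δ m)) ^ ((n : ℝ) / 2))
    have hw : ∀ m, Measurable (w m) := fun m => by fun_prop
    calc ∫⁻ r in Ioo 0 τ, g r
        ≤ ∫⁻ r in Ioo 0 τ, liminf (fun m => w m r * g r) atTop := by
          refine setLIntegral_mono' measurableSet_Ioo fun r hr => ?_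
          have hr' : 0 < τ - r := sub_pos.2 hr.2
          have h1 := tendsto_ofReal_ratio_rpow (q := (n : ℝ) / 2) hr' hδ0
            (tendsto_const_nhds (x := (0 : ℝ)))
          simp only [add_zero] at h1
          have h2 := ENNReal.Tendsto.mul h1 (Or.inl one_ne_zero)
            (tendsto_ofReal_ratio_rpow (q := (n : ℝ) / 2) hr' hδ0 hδ0) (Or.inl one_ne_zero)
          rw [one_mul] at h2
          have h3 := ENNReal.Tendsto.mul_const (b := g r) h2 (Or.inl one_ne_zero)
          rw [one_mul] at h3
          exact h3.liminf_eq.ge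
      _ ≤ liminf (fun m => ∫⁻ r in Ioo 0 τ, w m r * g r) atTop :=
          lintegral_liminf_le fun m => (hw m).mul hg
      _ ≤ liminf (fun m => L m z) atTop := by
          refine liminf_le_liminf (Eventually.of_forall fun m => ?_)
          refine le_trans (lintegral_mono fun r => ?_) (hL m z)
          gcongr
          exact hgle r
  · have hb : ∀ m, heatInt n (t - (δ m + δ m)) (L m) x
        ≤ ENNReal.ofReal (rexp (δ m)) * ENNReal.ofReal (rexp (δ m)) * R := fun m => by
      refine (hLb m _ (hδt m) x).trans_eq ?_
      have : ∀ r, τ - r + δ m + δ m + (t - (δ m + δ m)) = τ - r + t := fun r => by ring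
      simp_rw [this]
      rfl
    have hexp : Tendsto (fun m => ENNReal.ofReal (rexp (δ m))) atTop (𝓝 1) := by
      simpa [Function.comp_def] using (ENNReal.continuous_ofReal.tendsto _).comp
        ((Real.continuous_exp.tendsto _).comp hδ0)
    have hlim : Tendsto (fun m => ENNReal.ofReal (rexp (δ m)) * ENNReal.ofReal (rexp (δ m)) * R)
        atTop (𝓝 R) := by
      have h := ENNReal.Tendsto.mul_const (b := R)
        (ENNReal.Tendsto.mul hexp (Or.inl one_ne_zero) hexp (Or.inl one_ne_zero))
        (Or.inl (by simp))
      simpa using h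
    exact (liminf_le_liminf (Eventually.of_forall hb)).trans_eq hlim.liminf_eq

/-- Restarting the integral equation at time `τ`: the mild solution dominates the Duhamel
expression started from its value at time `τ`. -/
lemma heatInt_add_lintegral_le_of_mild (n : ℕ) {τ s : ℝ} (hτ : 0 < τ) (hτs : τ < s)
    {v₀ u v : EuclideanSpace ℝ (Fin n) → ℝ≥0∞} (hv₀ : Measurable v₀)
    {F : ℝ → EuclideanSpace ℝ (Fin n) → ℝ≥0∞}
    (hu : ∀ᵐ z, u z = heatInt n τ v₀ z + ∫⁻ r in Ioo 0 τ, heatInt n (τ - r) (F r) z)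
    (hv : ∀ᵐ z, v z = heatInt n s v₀ z + ∫⁻ r in Ioo 0 s, heatInt n (s - r) (F r) z) :
    ∀ᵐ z, heatInt n (s - τ) u z + ∫⁻ r in Ioo τ s, heatInt n (s - r) (F r) z ≤ v z := by
  filter_upwards [hv] with z hz
  have hst : 0 < s - τ := sub_pos.2 hτs
  have h1 : heatInt n (s - τ) u z
      ≤ heatInt n s v₀ z + ∫⁻ r in Ioo 0 τ, heatInt n (s - r) (F r) z := by
    refine (heatInt_mono_ae n (s - τ) (hu.mono fun y hy => hy.le) z).trans ?_
    unfold heatInt at hu ⊢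
    simp_rw [mul_add]
    rw [lintegral_add_left]
    · refine add_le_add ?_ ?_
      · have h := heatInt_heatInt_of_measurable n hτ hst hv₀ z
        rw [add_sub_cancel] at h
        exact h.le
      · have h := heatInt_lintegral_heatInt_le n (τ := τ) hst F z
        simp_rw [show ∀ r, τ - r + (s - τ) = s - r by intro r; ring] at h
        exact h
    · exact Measurable.mul (by fun_prop) (measurable_heatInt n τ v₀ hv₀)
  rw [hz]
  refine (add_le_add_left h1 _).trans ?_
  rw [add_assoc, ← lintegral_union measurableSet_Ioo]
  · gcongr
    exact union_subset (Ioo_subset_Ioo_right hτs.le) (Ioo_subset_Ioo_left hτ.le)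
  · exact Set.disjoint_left.2 fun r h h' => h.2.not_gt h'.1

lemma neBot_ae_restrict_Ioo {a b : ℝ} (hab : a < b) : (ae (volume.restrict (Ioo a b))).NeBot := by
  rw [ae_neBot, Ne, Measure.restrict_eq_zero, Real.volume_Ioo]
  simpa using hab

/-- A function growing at least as fast as the ODE `H' = K H ^ p` lives for a bounded time. -/
lemma blowup_time_le_of_forall_add_le {p K τ b : ℝ} (hp : 1 < p) (hK : 0 < K) (hτb : τ ≤ b)
    {H : ℝ → ℝ} (hH : ContinuousOn H (Icc τ b)) (hpos : ∀ s ∈ Icc τ b, 0 < H s)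
    (hgrow : ∀ s₁ ∈ Icc τ b, ∀ s₂ ∈ Icc τ b, s₁ ≤ s₂ →
      H s₁ + K * H s₁ ^ p * (s₂ - s₁) ≤ H s₂) :
    K * (p - 1) * (b - τ) ≤ H τ ^ (1 - p) := by
  have hmain := image_le_of_liminf_slope_right_le_deriv_boundary
    (f := fun s => H s ^ (1 - p)) (B := fun s => H τ ^ (1 - p) - K * (p - 1) * (s - τ))
    (B' := fun _ => -(K * (p - 1))) (a := τ) (b := b)
    (hH.rpow_const fun s hs => Or.inl (hpos s hs).ne') (by simp) (by fun_prop)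
    (fun s _ => by
      have h := (((hasDerivAt_id s).sub_const τ).const_mul (K * (p - 1))).const_sub
        (H τ ^ (1 - p))
      simpa using h.hasDerivWithinAt)
    (fun s hs r hr => by
      have hs' : s ∈ Icc τ b := Ico_subset_Icc_self hs
      have hHs := hpos s hs'
      have hder : HasDerivAt (fun z => (H s + K * H s ^ p * (z - s)) ^ (1 - p))
          (-(K * (p - 1))) s := by
        have h1 : HasDerivAt (fun z => H s + K * H s ^ p * (z - s)) (K * H s ^ p) s := by
          simpa using (((hasDerivAt_id s).sub_const s).const_mul (K * H s ^ p)).const_add (H s)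
        have h2 := h1.rpow_const (p := 1 - p) (Or.inl (by simpa using hHs.ne'))
        convert h2 using 1
        have h3 : H s ^ p * H s ^ (1 - p - 1) = 1 := by
          rw [← Real.rpow_add hHs]
          simp
        simp only [sub_self, mul_zero, add_zero]
        linear_combination (-(K * (1 - p))) * h3
      have hslope := (hasDerivAt_iff_tendsto_slope.1 hder).mono_left
        (nhdsWithin_mono s fun z (hz : s < z) => hz.ne')
      have hev : ∀ᶠ z in 𝓝[>] s, z ∈ Ioo s b := Ioo_mem_nhdsGT hs.2
      refine Eventually.frequently ?_
      filter_upwards [hslope.eventually_lt_const hr, hev] with z hz hzb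
      refine lt_of_le_of_lt ?_ hz
      have hzs : 0 < z - s := sub_pos.2 hzb.1
      have hle := hgrow s hs' z ⟨hs'.1.trans hzb.1.le, hzb.2.le⟩ hzb.1.le
      have hlow : 0 < H s + K * H s ^ p * (z - s) := by positivity
      rw [slope_def_field, slope_def_field, sub_self, mul_zero, add_zero]
      gcongr ?_ / _
      gcongr ?_ - _
      exact Real.rpow_le_rpow_of_nonpos hlow hle (by linarith))
  have hb := hmain (right_mem_Icc.2 hτb)
  have := Real.rpow_pos_of_pos (hpos b (right_mem_Icc.2 hτb)) (1 - p)
  linarith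

lemma le_ofReal_of_forall_add_lintegral_rpow_le {p K τ σ : ℝ} (hp : 1 < p) (hK : 0 < K)
    (hτσ : τ < σ) {a : ℝ≥0∞} {V : ℝ → ℝ≥0∞} (hV : Measurable V)
    (h : ∀ᵐ s ∂(volume.restrict (Ioo τ σ)),
      V s ≠ ⊤ ∧ a + ENNReal.ofReal K * ∫⁻ r in Ioo τ s, V r ^ p ≤ V s) :
    a ≤ ENNReal.ofReal ((K * (p - 1) * (σ - τ)) ^ (-(1 / (p - 1)))) := by
  have hp0 : 0 < p := by linarith
  have hp1 : 0 < p - 1 := by linarith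
  have hex : ∀ b, τ ≤ b → b < σ → ∃ s, s ∈ Ioo b σ ∧
      V s ≠ ⊤ ∧ a + ENNReal.ofReal K * ∫⁻ r in Ioo τ s, V r ^ p ≤ V s := fun b hb hbσ => by
    have := neBot_ae_restrict_Ioo hbσ
    exact ((ae_restrict_mem measurableSet_Ioo).and
      (ae_restrict_of_ae_restrict_of_subset (Ioo_subset_Ioo_left hb) h)).exists
  have hfin : ∀ s, V s ≠ ⊤ → a + ENNReal.ofReal K * ∫⁻ r in Ioo τ s, V r ^ p ≤ V s →
      ∫⁻ r in Ioo τ s, V r ^ p ≠ ⊤ := fun s hs hle htop => by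
    rw [htop, ENNReal.mul_top (ENNReal.ofReal_pos.2 hK).ne', add_top, top_le_iff] at hle
    exact hs hle
  have ha : a ≠ ⊤ := by
    obtain ⟨s, -, hs, hle⟩ := hex τ le_rfl hτσ
    exact ne_top_of_le_ne_top hs (le_self_add.trans hle)
  rcases eq_or_ne a 0 with rfl | ha0
  · exact zero_le
  set A := a.toReal with hA
  have hApos : 0 < A := ENNReal.toReal_pos ha0 ha
  set u : ℝ → ℝ := fun r => (V r ^ p).toReal with hu
  have hu0 : ∀ r, 0 ≤ u r := fun r => ENNReal.toReal_nonneg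
  have hVp : Measurable fun r => V r ^ p := hV.pow_const p
  have h_int : ∀ s₁ s₂, τ ≤ s₁ → s₁ ≤ s₂ → s₂ < σ → IntervalIntegrable u volume s₁ s₂ := by
    intro s₁ s₂ h1 h12 h2
    obtain ⟨s, hs, hst, hle⟩ := hex s₂ (h1.trans h12) h2
    have hi : IntegrableOn u (Ioo τ s) :=
      integrable_toReal_of_lintegral_ne_top hVp.aemeasurable (hfin s hst hle)
    rw [intervalIntegrable_iff_integrableOn_Ioo_of_le h12]
    exact hi.mono_set (Ioo_subset_Ioo h1 hs.1.le)
  set H : ℝ → ℝ := fun s => A + K * ∫ r in τ..s, u r with hH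
  have hHadd : ∀ s₁ s₂, τ ≤ s₁ → s₁ ≤ s₂ → s₂ < σ → H s₂ = H s₁ + K * ∫ r in s₁..s₂, u r := by
    intro s₁ s₂ h1 h12 h2
    have := intervalIntegral.integral_add_adjacent_intervals
      (h_int τ s₁ le_rfl h1 (h12.trans_lt h2)) (h_int s₁ s₂ h1 h12 h2)
    simp only [hH]
    rw [← this]
    ring
  have hHmono : ∀ s₁ s₂, τ ≤ s₁ → s₁ ≤ s₂ → s₂ < σ → H s₁ ≤ H s₂ := by
    intro s₁ s₂ h1 h12 h2
    rw [hHadd s₁ s₂ h1 h12 h2]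
    have : 0 ≤ ∫ r in s₁..s₂, u r := intervalIntegral.integral_nonneg h12 fun r _ => hu0 r
    nlinarith
  have hHτ : H τ = A := by simp [hH]
  have hHV : ∀ᵐ s ∂(volume.restrict (Ioo τ σ)), H s ^ p ≤ u s := by
    filter_upwards [h, ae_restrict_mem measurableSet_Ioo] with s hs hsm
    have hIt := hfin s hs.1 hs.2
    have hI : ∫ r in τ..s, u r = (∫⁻ r in Ioo τ s, V r ^ p).toReal := by
      rw [intervalIntegral.integral_of_le hsm.1.le, integral_Ioc_eq_integral_Ioo, hu,
        integral_toReal hVp.aemeasurable (ae_lt_top hVp hIt)]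
    have hle := ENNReal.toReal_mono hs.1 hs.2
    rw [ENNReal.toReal_add ha (ENNReal.mul_ne_top ENNReal.ofReal_ne_top hIt), ENNReal.toReal_mul,
      ENNReal.toReal_ofReal hK.le, ← hI] at hle
    have hHs : 0 ≤ H s := by
      have := hHmono τ s le_rfl hsm.1.le hsm.2
      linarith
    simp only [hu, ← ENNReal.toReal_rpow]
    exact Real.rpow_le_rpow hHs hle hp0.le
  have hgrow : ∀ s₁ s₂, τ ≤ s₁ → s₁ ≤ s₂ → s₂ < σ → H s₁ + K * H s₁ ^ p * (s₂ - s₁) ≤ H s₂ := by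
    intro s₁ s₂ h1 h12 h2
    rw [hHadd s₁ s₂ h1 h12 h2, mul_assoc]
    gcongr
    have hc : H s₁ ^ p * (s₂ - s₁) = ∫ _ in s₁..s₂, H s₁ ^ p := by
      rw [intervalIntegral.integral_const, smul_eq_mul, mul_comm]
    have hHs : 0 ≤ H s₁ := by
      have := hHmono τ s₁ le_rfl h1 (h12.trans_lt h2)
      linarith
    rw [hc, intervalIntegral.integral_of_le h12, intervalIntegral.integral_of_le h12,
      integral_Ioc_eq_integral_Ioo, integral_Ioc_eq_integral_Ioo]
    refine integral_mono_ae (integrable_const _)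
      ((intervalIntegrable_iff_integrableOn_Ioo_of_le h12).1 (h_int s₁ s₂ h1 h12 h2)) ?_
    filter_upwards [ae_restrict_of_ae_restrict_of_subset (Ioo_subset_Ioo h1 h2.le) hHV,
      ae_restrict_mem measurableSet_Ioo] with r hr hrm
    exact (Real.rpow_le_rpow hHs (hHmono s₁ r h1 hrm.1.le (hrm.2.trans h2)) hp0.le).trans hr
  have hbound : ∀ b ∈ Ioo τ σ, K * (p - 1) * (b - τ) ≤ A ^ (1 - p) := fun b hb => by
    rw [← hHτ]
    refine blowup_time_le_of_forall_add_le hp hK hb.1.le ?_ (fun s hs => ?_) ?_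
    · have hi := h_int τ b le_rfl hb.1.le hb.2
      have hc := intervalIntegral.continuousOn_primitive_interval'
        hi (left_mem_uIcc (a := τ) (b := b))
      rw [uIcc_of_le hb.1.le] at hc
      exact continuousOn_const.add (continuousOn_const.mul hc)
    · have := hHmono τ s le_rfl hs.1 (hs.2.trans_lt hb.2)
      linarith
    · exact fun s₁ h1 s₂ h2 h12 => hgrow s₁ s₂ h1.1 h12 (h2.2.trans_lt hb.2)
  have hlim : K * (p - 1) * (σ - τ) ≤ A ^ (1 - p) := by
    have ht : Tendsto (fun b => K * (p - 1) * (b - τ)) (𝓝[<] σ) (𝓝 (K * (p - 1) * (σ - τ))) :=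
      (Continuous.tendsto (by fun_prop) σ).mono_left nhdsWithin_le_nhds
    exact le_of_tendsto ht (by filter_upwards [Ioo_mem_nhdsLT hτσ] with b hb using hbound b hb)
  rw [← ENNReal.ofReal_toReal ha]
  refine ENNReal.ofReal_le_ofReal ?_
  have hstp : 0 < K * (p - 1) * (σ - τ) := mul_pos (mul_pos hK hp1) (sub_pos.2 hτσ)
  have hq : -(1 / (p - 1)) ≤ 0 := by rw [neg_nonpos]; positivity
  have := Real.rpow_le_rpow_of_nonpos hstp hlim hq
  rwa [← Real.rpow_mul hApos.le, show (1 - p) * -(1 / (p - 1)) = 1 by field_simp; ring,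
    Real.rpow_one] at this

/-- Duhamel lower bound along the backward heat flow from `(σ, x)`, with the source replaced by a
power nonlinearity it dominates. -/
lemma heatInt_add_lintegral_rpow_le (n : ℕ) {p K τ s σ : ℝ} (hp : 1 < p) (hτs : τ < s)
    (hsσ : s < σ) {ϑ : ℝ → EuclideanSpace ℝ (Fin n) → ℝ≥0∞}
    (hϑ : Measurable (Function.uncurry ϑ)) {F : ℝ → EuclideanSpace ℝ (Fin n) → ℝ≥0∞}
    (hF : ∀ᵐ r ∂(volume.restrict (Ioo τ s)), ∀ᵐ y, ENNReal.ofReal K * ϑ r y ^ p ≤ F r y)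
    (h : ∀ᵐ z, heatInt n (s - τ) (ϑ τ) z + ∫⁻ r in Ioo τ s, heatInt n (s - r) (F r) z ≤ ϑ s z)
    (x : EuclideanSpace ℝ (Fin n)) :
    heatInt n (σ - τ) (ϑ τ) x
      + ENNReal.ofReal K * ∫⁻ r in Ioo τ s, heatInt n (σ - r) (ϑ r) x ^ p
        ≤ heatInt n (σ - s) (ϑ s) x := by
  have hσs : 0 < σ - s := sub_pos.2 hsσ
  have hϑr : ∀ r, Measurable (ϑ r) := fun r => hϑ.of_uncurry_left
  have hg : Measurable fun q : ℝ × EuclideanSpace ℝ (Fin n) =>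
      ENNReal.ofReal K * ϑ q.1 q.2 ^ p := (hϑ.pow_const p).const_mul _
  have hGm : Measurable fun q : EuclideanSpace ℝ (Fin n) × ℝ =>
      heatInt n (s - q.2) (fun y => ENNReal.ofReal K * ϑ q.2 y ^ p) q.1 :=
    measurable_heatInt_comp n (by fun_prop) measurable_fst
      (v := fun q : EuclideanSpace ℝ (Fin n) × ℝ => fun y => ENNReal.ofReal K * ϑ q.2 y ^ p)
      (hg.comp (by fun_prop : Measurable fun w : (EuclideanSpace ℝ (Fin n) × ℝ) ×
        EuclideanSpace ℝ (Fin n) => (w.1.2, w.2)))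
  have hk : Measurable fun z => eheatKernel n (σ - s) (x - z) := by fun_prop
  calc heatInt n (σ - τ) (ϑ τ) x
        + ENNReal.ofReal K * ∫⁻ r in Ioo τ s, heatInt n (σ - r) (ϑ r) x ^ p
      ≤ heatInt n (σ - τ) (ϑ τ) x + ∫⁻ r in Ioo τ s, heatInt n (σ - s)
          (heatInt n (s - r) (fun y => ENNReal.ofReal K * ϑ r y ^ p)) x := by
        refine add_le_add le_rfl ?_
        rw [← lintegral_const_mul' _ _ ENNReal.ofReal_ne_top]
        refine setLIntegral_mono' measurableSet_Ioo fun r hr => ?_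
        rw [heatInt_heatInt n (sub_pos.2 hr.2) hσs, sub_add_sub_cancel']
        calc ENNReal.ofReal K * heatInt n (σ - r) (ϑ r) x ^ p
            ≤ ENNReal.ofReal K * heatInt n (σ - r) (fun y => ϑ r y ^ p) x := by
              gcongr
              exact heatInt_rpow_le n (sub_pos.2 (hr.2.trans hsσ)) hp (hϑr r) x
          _ = heatInt n (σ - r) (fun y => ENNReal.ofReal K * ϑ r y ^ p) x := by
              unfold heatInt
              rw [← lintegral_const_mul' _ _ ENNReal.ofReal_ne_top]
              exact lintegral_congr fun y => mul_left_comm _ _ _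
    _ = heatInt n (σ - s) (heatInt n (s - τ) (ϑ τ)) x + heatInt n (σ - s)
          (fun z => ∫⁻ r in Ioo τ s,
            heatInt n (s - r) (fun y => ENNReal.ofReal K * ϑ r y ^ p) z) x := by
        rw [heatInt_heatInt n (sub_pos.2 hτs) hσs, sub_add_sub_cancel']
        congr 1
        rw [heatInt]
        simp_rw [← lintegral_const_mul _ (hGm.of_uncurry_left (f := fun z r =>
          heatInt n (s - r) (fun y => ENNReal.ofReal K * ϑ r y ^ p) z))]
        exact lintegral_lintegral_swap (((hk.comp measurable_snd).mul
          (hGm.comp measurable_swap)).aemeasurable)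
    _ = heatInt n (σ - s) (fun z => heatInt n (s - τ) (ϑ τ) z + ∫⁻ r in Ioo τ s,
            heatInt n (s - r) (fun y => ENNReal.ofReal K * ϑ r y ^ p) z) x := by
        unfold heatInt
        simp_rw [mul_add]
        exact (lintegral_add_left (hk.mul (measurable_heatInt n _ _ (hϑr τ))) _).symm
    _ ≤ heatInt n (σ - s) (ϑ s) x := by
        refine heatInt_mono_ae n _ (h.mono fun z hz => le_trans ?_ hz) x
        refine add_le_add le_rfl ?_
        exact lintegral_mono_ae (hF.mono fun r hr => heatInt_mono_ae n _ hr z)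


theorem decay_bound_of_solution_at_later_times
    (n : ℕ) (hn : 1 ≤ n) (p T K₂ : ℝ) (hp : 1 < p) (hT : 0 < T) (hK₂ : 0 < K₂)
    (f : ℝ → ℝ) (hf0 : ∀ u ≥ (0 : ℝ), 0 ≤ f u)
    (hfloc : LocallyIntegrableOn f (Set.Ici 0) volume)
    (hfK : ∀ u ≥ (0 : ℝ), K₂ * u ^ p ≤ f u)
    (ϑ₀ : EuclideanSpace ℝ (Fin n) → ℝ≥0∞) (hϑ₀ : Measurable ϑ₀)
    (ϑ : ℝ → EuclideanSpace ℝ (Fin n) → ℝ≥0∞) (hϑ : Measurable (Function.uncurry ϑ))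
    (hfin : ∀ᵐ q ∂((volume.restrict (Set.Icc (0 : ℝ) T)).prod
        (volume : Measure (EuclideanSpace ℝ (Fin n)))), ϑ q.1 q.2 < ⊤)
    (heq : ∀ᵐ q ∂((volume.restrict (Set.Icc (0 : ℝ) T)).prod
        (volume : Measure (EuclideanSpace ℝ (Fin n)))),
      ϑ q.1 q.2 = heatSem n q.1 ϑ₀ q.2
        + ∫⁻ s in Set.Ioc (0 : ℝ) q.1,
            heatSem n (q.1 - s) (fun y => ENNReal.ofReal (f ((ϑ s y).toReal))) q.2) :
    ∀ᵐ τ ∂(volume.restrict (Set.Ioo (0 : ℝ) T)),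
      ∀ t : ℝ, 0 < t → t ≤ T - τ →
        ENNReal.ofReal (t ^ (1 / (p - 1))) * essSup (heatSem n t (ϑ τ)) volume
          ≤ ENNReal.ofReal ((K₂ * (p - 1)) ^ (-(1 / (p - 1)))) := by
  set F : ℝ → EuclideanSpace ℝ (Fin n) → ℝ≥0∞ :=
    fun s y => ENNReal.ofReal (f ((ϑ s y).toReal)) with hF
  have hp1 : 0 < p - 1 := sub_pos.2 hp
  have hϑr : ∀ r, Measurable (ϑ r) := fun r => hϑ.of_uncurry_left
  have hgood : ∀ᵐ s ∂(volume.restrict (Set.Ioo (0 : ℝ) T)), (∀ᵐ z, ϑ s z < ⊤) ∧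
      ∀ᵐ z, ϑ s z = heatInt n s ϑ₀ z + ∫⁻ r in Set.Ioo 0 s, heatInt n (s - r) (F r) z := by
    filter_upwards [ae_restrict_of_ae_restrict_of_subset Set.Ioo_subset_Icc_self
        (Measure.ae_ae_of_ae_prod hfin),
      ae_restrict_of_ae_restrict_of_subset Set.Ioo_subset_Icc_self
        (Measure.ae_ae_of_ae_prod heq), ae_restrict_mem measurableSet_Ioo] with s hs1 hs2 hs
    refine ⟨hs1, hs2.mono fun z hz => ?_⟩
    rw [hz, heatSem_eq_heatInt n hs.1.ne', setLIntegral_congr Ioo_ae_eq_Ioc.symm]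
    congr 1
    exact setLIntegral_congr_fun measurableSet_Ioo fun r hr =>
      heatSem_eq_heatInt n (sub_pos.2 hr.2).ne' _ z
  have hFle : ∀ s, (∀ᵐ z, ϑ s z < ⊤) → ∀ᵐ y, ENNReal.ofReal K₂ * ϑ s y ^ p ≤ F s y :=
    fun s hs => hs.mono fun y hy => by
      have h := ENNReal.ofReal_le_ofReal (hfK (ϑ s y).toReal ENNReal.toReal_nonneg)
      rwa [ENNReal.ofReal_mul hK₂.le, ENNReal.toReal_rpow,
        ENNReal.ofReal_toReal (ENNReal.rpow_ne_top_of_nonneg (by linarith) hy.ne)] at h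
  filter_upwards [hgood, ae_restrict_mem measurableSet_Ioo] with τ hτ hτm
  have hbound : ∀ σ, τ < σ → σ < T → ∀ x, heatInt n (σ - τ) (ϑ τ) x
      ≤ ENNReal.ofReal ((K₂ * (p - 1) * (σ - τ)) ^ (-(1 / (p - 1)))) := by
    intro σ hτσ hσT x
    have hgood' := ae_restrict_of_ae_restrict_of_subset
      (Set.Ioo_subset_Ioo hτm.1.le hσT.le : Set.Ioo τ σ ⊆ Set.Ioo 0 T) hgood
    refine le_ofReal_of_forall_add_lintegral_rpow_le hp hK₂ hτσ
      (V := fun s => heatInt n (σ - s) (ϑ s) x)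
      (measurable_heatInt_comp n (by fun_prop) measurable_const hϑ) ?_
    filter_upwards [hgood', ae_restrict_mem measurableSet_Ioo] with s hs hsm
    have hs0 : 0 < s := hτm.1.trans hsm.1
    constructor
    · have := neBot_ae_restrict_Ioo hσT
      obtain ⟨s', hs'm, hs'⟩ := ((ae_restrict_mem measurableSet_Ioo).and
        (ae_restrict_of_ae_restrict_of_subset
          (Set.Ioo_subset_Ioo_left (hs0.trans hsm.2).le) hgood)).exists
      obtain ⟨z, hz, hzt⟩ := ((heatInt_add_lintegral_le_of_mild n hs0 (hsm.2.trans hs'm.1) hϑ₀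
        hs.2 hs'.2).and hs'.1).exists
      exact heatInt_ne_top_of_lt n (sub_pos.2 hsm.2) (sub_lt_sub_right hs'm.1 s)
        (ne_top_of_le_ne_top hzt.ne (le_self_add.trans hz))
    · refine heatInt_add_lintegral_rpow_le n hp hsm.1 hsm.2 hϑ ?_
        (heatInt_add_lintegral_le_of_mild n hτm.1 hsm.1 hϑ₀ hτ.2 hs.2) x
      exact (ae_restrict_of_ae_restrict_of_subset
        (Set.Ioo_subset_Ioo_right hsm.2.le) hgood').mono fun r hr => hFle r hr.1
  intro t ht htT
  have hpt : ∀ x, heatInt n t (ϑ τ) x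
      ≤ ENNReal.ofReal ((K₂ * (p - 1) * t) ^ (-(1 / (p - 1)))) := by
    intro x
    let s : ℕ → ℝ := fun k => t - t / 2 * (1 / ((k : ℝ) + 1))
    have hs : Tendsto s atTop (𝓝 t) := by
      simpa [s] using
        (tendsto_one_div_add_atTop_nhds_zero_nat.const_mul (t / 2)).const_sub t
    have hst : ∀ k, s k < t := fun k => sub_lt_self _ (by positivity)
    have hs0 : ∀ k, 0 < s k := fun k => by
      have h1 : 1 / ((k : ℝ) + 1) ≤ 1 := by
        rw [div_le_one (by positivity)]
        linarith [Nat.cast_nonneg (α := ℝ) k]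
      have := mul_le_mul_of_nonneg_left h1 (by positivity : 0 ≤ t / 2)
      simp only [s]
      linarith
    refine (heatInt_le_liminf n ht hs (w := fun _ => ϑ τ) (fun _ => hϑr τ)
      (fun y => by simp) x).trans ?_
    have hlim : Tendsto (fun k => ENNReal.ofReal ((K₂ * (p - 1) * s k) ^ (-(1 / (p - 1)))))
        atTop (𝓝 (ENNReal.ofReal ((K₂ * (p - 1) * t) ^ (-(1 / (p - 1)))))) :=
      (ENNReal.continuous_ofReal.tendsto _).comp
        ((hs.const_mul _).rpow_const (Or.inl (by positivity)))
    refine (liminf_le_liminf (Eventually.of_forall fun k => ?_)).trans_eq hlim.liminf_eq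
    have h := hbound (τ + s k) (by linarith [hs0 k]) (by linarith [hst k]) x
    rwa [add_sub_cancel_left] at h
  have hess : essSup (heatSem n t (ϑ τ)) volume
      ≤ ENNReal.ofReal ((K₂ * (p - 1) * t) ^ (-(1 / (p - 1)))) :=
    essSup_le_of_ae_le _ (ae_of_all _ fun x => by
      rw [heatSem_eq_heatInt n ht.ne']
      exact hpt x)
  calc ENNReal.ofReal (t ^ (1 / (p - 1))) * essSup (heatSem n t (ϑ τ)) volume
      ≤ ENNReal.ofReal (t ^ (1 / (p - 1)))
        * ENNReal.ofReal ((K₂ * (p - 1) * t) ^ (-(1 / (p - 1)))) := by gcongr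
    _ = ENNReal.ofReal ((K₂ * (p - 1)) ^ (-(1 / (p - 1)))) := by
      rw [← ENNReal.ofReal_mul (by positivity), Real.mul_rpow (by positivity) ht.le,
        mul_left_comm, ← Real.rpow_add ht, add_neg_cancel, Real.rpow_zero, mul_one]
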